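/- (Self-adjointness of the bosonic Laplacian, scalar-valued case) Let m ≥ 3 and k ≥ 1 be integers, and let f, g : ℝ^m × ℝ^m → ℝ take values in H_k with C² coefficients. Assume f is compactly supported in x, i.e. there is a compact set K ⊂ ℝ^m with f(x,u) = 0 whenever x ∉ K. Then ∫_{ℝ^m} ∫_{S^{m−1}} (D_k f)(x,u) g(x,u) dS(u) dx = ∫_{ℝ^m} ∫_{S^{m−1}} f(x,u) (D_k g)(x,u) dS(u) dx; that is, D_k is self-adjoint with respect to the inner product ⟨f | g⟩ = ∫_{ℝ^m}∫_{S^{m−1}} f(x,u) g(x,u) dS(u) dx on compactly x-supported functions. -/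

import Mathlib

open MeasureTheory
open scoped RealInnerProductSpace

noncomputable section

/-- Partial derivative `∂_{x_i} g(x)` of a function of one Euclidean variable. -/
def pd {m : ℕ} {V : Type*} [NormedAddCommGroup V] [NormedSpace ℝ V]
    (g : EuclideanSpace ℝ (Fin m) → V) (i : Fin m) :
    EuclideanSpace ℝ (Fin m) → V :=
  fun x => fderiv ℝ g x (EuclideanSpace.single i 1)

/-- Partial derivative `∂_{x_i} f(x,u)` in the first variable of a function of two
Euclidean variables. -/
def pdx {m : ℕ} {V : Type*} [NormedAddCommGroup V] [NormedSpace ℝ V]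
    (f : EuclideanSpace ℝ (Fin m) → EuclideanSpace ℝ (Fin m) → V) (i : Fin m) :
    EuclideanSpace ℝ (Fin m) → EuclideanSpace ℝ (Fin m) → V :=
  fun x u => fderiv ℝ (fun x' => f x' u) x (EuclideanSpace.single i 1)

/-- Partial derivative `∂_{u_i} f(x,u)` in the second variable of a function of two
Euclidean variables. -/
def pdu {m : ℕ} {V : Type*} [NormedAddCommGroup V] [NormedSpace ℝ V]
    (f : EuclideanSpace ℝ (Fin m) → EuclideanSpace ℝ (Fin m) → V) (i : Fin m) :
    EuclideanSpace ℝ (Fin m) → EuclideanSpace ℝ (Fin m) → V :=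
  fun x u => fderiv ℝ (fun u' => f x u') u (EuclideanSpace.single i 1)

/-- `f(x,u)` takes values in `H_k`: `f(x,u) = Σ_{|α|=k} c_α(x) u^α` with all coefficients
`c_α` satisfying the regularity predicate `P`, and `u ↦ f(x,u)` harmonic for every `x`. -/
def ValuesInHk (m k : ℕ) (P : (EuclideanSpace ℝ (Fin m) → ℝ) → Prop)
    (f : EuclideanSpace ℝ (Fin m) → EuclideanSpace ℝ (Fin m) → ℝ) : Prop :=
  (∃ (s : Finset (Fin m → ℕ)) (c : (Fin m → ℕ) → EuclideanSpace ℝ (Fin m) → ℝ),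
      (∀ α ∈ s, ∑ i, α i = k) ∧ (∀ α ∈ s, P (c α)) ∧
      (∀ x u, f x u = ∑ α ∈ s, c α x * ∏ i, (u i) ^ (α i))) ∧
  (∀ x u, ∑ j, pdu (pdu f j) j x u = 0)

/-- The bosonic Laplacian (higher spin Laplace operator) `D_k`. -/
def bosonicLaplacian (m k : ℕ)
    (f : EuclideanSpace ℝ (Fin m) → EuclideanSpace ℝ (Fin m) → ℝ) :
    EuclideanSpace ℝ (Fin m) → EuclideanSpace ℝ (Fin m) → ℝ :=
  fun x u =>
    (∑ i, pdx (pdx f i) i x u)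
      - (4 / ((m : ℝ) + 2 * k - 2)) * ∑ i, ∑ j, u i * pdu (pdx (pdx f j) i) j x u
      + (4 * ‖u‖ ^ 2 / (((m : ℝ) + 2 * k - 2) * ((m : ℝ) + 2 * k - 4))) *
          ∑ i, ∑ j, pdu (pdu (pdx (pdx f j) i) j) i x u

/-- The surface measure `dS` on the unit sphere `S^{m-1} ⊆ ℝ^m`. -/
def sphereMeasure (m : ℕ) : Measure (Metric.sphere (0 : EuclideanSpace ℝ (Fin m)) 1) :=
  (volume : Measure (EuclideanSpace ℝ (Fin m))).toSphere

open MvPolynomial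

section HarmonicPolynomials

variable {m : ℕ}

lemma MvPolynomial.pderiv_pderiv_comm {σ R : Type*} [CommRing R] (i j : σ)
    (p : MvPolynomial σ R) : pderiv i (pderiv j p) = pderiv j (pderiv i p) := by
  classical
  have h : ⁅pderiv (R := R) i, pderiv (R := R) j⁆ = 0 := by
    apply MvPolynomial.derivation_ext
    intro l
    rw [Derivation.commutator_apply, pderiv_X, pderiv_X]
    by_cases h1 : i = l <;> by_cases h2 : j = l <;> simp [eq_comm, h1, h2]
  have := congrArg (fun D => D p) h
  simpa [Derivation.commutator_apply, sub_eq_zero] using this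

lemma hasFDerivAt_eval_mvPolynomial (p : MvPolynomial (Fin m) ℝ) (u : EuclideanSpace ℝ (Fin m)) :
    HasFDerivAt (fun v : EuclideanSpace ℝ (Fin m) => eval v.ofLp p)
      (∑ i, eval u.ofLp (pderiv i p) • (EuclideanSpace.proj i : EuclideanSpace ℝ (Fin m) →L[ℝ] ℝ))
      u := by
  induction p using MvPolynomial.induction_on with
  | C a => simpa using hasFDerivAt_const a u
  | add p q hp hq =>
    simp only [map_add, add_smul, Finset.sum_add_distrib]
    exact hp.add hq
  | mul_X p j hp =>
    have hX : HasFDerivAt (fun v : EuclideanSpace ℝ (Fin m) => v.ofLp j)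
        (EuclideanSpace.proj j : EuclideanSpace ℝ (Fin m) →L[ℝ] ℝ) u :=
      (EuclideanSpace.proj j : EuclideanSpace ℝ (Fin m) →L[ℝ] ℝ).hasFDerivAt
    simp only [map_mul, eval_X]
    refine (hp.mul hX).congr_fderiv ?_
    ext v
    simp [add_mul, Finset.sum_add_distrib, Pi.single_apply, apply_ite, ite_mul,
      Finset.mul_sum]
    exact Finset.sum_congr rfl fun i _ => by ring

lemma fderiv_eval_mvPolynomial_single (p : MvPolynomial (Fin m) ℝ)
    (u : EuclideanSpace ℝ (Fin m)) (i : Fin m) :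
    fderiv ℝ (fun v : EuclideanSpace ℝ (Fin m) => eval v.ofLp p) u (EuclideanSpace.single i 1) =
      eval u.ofLp (pderiv i p) := by
  rw [(hasFDerivAt_eval_mvPolynomial p u).fderiv]
  simp

lemma continuous_eval_mvPolynomial (p : MvPolynomial (Fin m) ℝ) :
    Continuous fun v : EuclideanSpace ℝ (Fin m) => eval v.ofLp p :=
  p.continuous_eval.comp (PiLp.continuous_ofLp 2 _)

lemma integrable_eval_mul_exp_neg_norm_sq [NeZero m] (p : MvPolynomial (Fin m) ℝ) :
    Integrable fun u : EuclideanSpace ℝ (Fin m) => eval u.ofLp p * Real.exp (-‖u‖ ^ 2) := by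
  induction p using MvPolynomial.induction_on' with
  | add p q hp hq =>
    simp only [map_add, add_mul]
    exact hp.add hq
  | monomial d a =>
    set n := ∑ i, d i
    have h : Integrable fun u : EuclideanSpace ℝ (Fin m) =>
        ‖u‖ ^ n * Real.exp (-‖u‖ ^ 2) := by
      rw [integrable_fun_norm_addHaar volume (f := fun r : ℝ => r ^ n * Real.exp (-r ^ 2))]
      have h0 := integrableOn_rpow_mul_exp_neg_mul_sq (b := 1) one_pos
        (s := ((m - 1 + n : ℕ) : ℝ)) (by linarith [Nat.cast_nonneg (α := ℝ) (m - 1 + n)])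
      refine h0.congr_fun (fun r _ => ?_) measurableSet_Ioi
      simp only [Real.rpow_natCast, finrank_euclideanSpace_fin, smul_eq_mul, pow_add, neg_mul,
        one_mul]
      ring
    refine (h.const_mul |a|).mono' ?_ (Filter.Eventually.of_forall fun u => ?_)
    · exact ((continuous_eval_mvPolynomial _).mul (by fun_prop)).aestronglyMeasurable
    · rw [eval_monomial, Finsupp.prod_fintype _ _ (by simp), norm_mul, norm_mul, norm_prod,
        Real.norm_eq_abs a, Real.norm_of_nonneg (Real.exp_pos _).le, ← mul_assoc]
      gcongr
      rw [← Finset.prod_pow_eq_pow_sum]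
      refine Finset.prod_le_prod (fun _ _ => by positivity) fun i _ => ?_
      rw [norm_pow]
      gcongr
      exact PiLp.norm_apply_le u i

/-- The integral of a polynomial against the Gaussian weight `exp (-‖u‖²)`. -/
def gaussianIntegral [NeZero m] : MvPolynomial (Fin m) ℝ →ₗ[ℝ] ℝ where
  toFun p := ∫ u : EuclideanSpace ℝ (Fin m), eval u.ofLp p * Real.exp (-‖u‖ ^ 2)
  map_add' p q := by
    rw [← integral_add (integrable_eval_mul_exp_neg_norm_sq p)
      (integrable_eval_mul_exp_neg_norm_sq q)]
    simp [add_mul]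
  map_smul' c p := by
    simp [mul_assoc, integral_const_mul]

lemma gaussianIntegral_pderiv [NeZero m] (i : Fin m) (p : MvPolynomial (Fin m) ℝ) :
    gaussianIntegral (pderiv i p) = 2 * gaussianIntegral (X i * p) := by
  have hw : ∀ u : EuclideanSpace ℝ (Fin m), HasFDerivAt (fun v => Real.exp (-‖v‖ ^ 2))
      (Real.exp (-‖u‖ ^ 2) • -((2 : ℕ) • innerSL ℝ u)) u := fun u => by
    simpa using (hasStrictFDerivAt_norm_sq u).hasFDerivAt.neg.exp
  have hw' : ∀ u : EuclideanSpace ℝ (Fin m),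
      fderiv ℝ (fun v => Real.exp (-‖v‖ ^ 2)) u (EuclideanSpace.single i 1) =
        -2 * u i * Real.exp (-‖u‖ ^ 2) := fun u => by
    rw [(hw u).fderiv]
    simp [EuclideanSpace.inner_single_right]
    ring
  have key := integral_mul_fderiv_eq_neg_fderiv_mul_of_integrable
    (μ := (volume : Measure (EuclideanSpace ℝ (Fin m))))
    (f := fun u => eval u.ofLp p) (g := fun u => Real.exp (-‖u‖ ^ 2))
    (v := EuclideanSpace.single i 1) ?_ ?_ (integrable_eval_mul_exp_neg_norm_sq p)
    (fun u _ => (hasFDerivAt_eval_mvPolynomial p u).differentiableAt)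
    (fun u _ => (hw u).differentiableAt)
  · simp only [hw', fderiv_eval_mvPolynomial_single] at key
    simp only [gaussianIntegral, LinearMap.coe_mk, AddHom.coe_mk, ← integral_const_mul]
    rw [← neg_eq_iff_eq_neg] at key
    rw [← key, ← integral_neg]
    congr 1; ext u; simp; ring
  · simpa only [fderiv_eval_mvPolynomial_single] using
      integrable_eval_mul_exp_neg_norm_sq (pderiv i p)
  · simp only [hw']
    convert integrable_eval_mul_exp_neg_norm_sq (-2 * X i * p) using 2
    simp; ring

lemma integrable_sphere_eval (p : MvPolynomial (Fin m) ℝ) :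
    Integrable (fun u : Metric.sphere (0 : EuclideanSpace ℝ (Fin m)) 1 =>
      eval (u : EuclideanSpace ℝ (Fin m)).ofLp p) (sphereMeasure m) := by
  have : IsFiniteMeasure (sphereMeasure m) := by unfold sphereMeasure; infer_instance
  exact ((continuous_eval_mvPolynomial p).comp
    continuous_subtype_val).integrable_of_hasCompactSupport (HasCompactSupport.of_compactSpace _)

/-- The integral of a polynomial over the unit sphere. -/
def sphereIntegral (m : ℕ) : MvPolynomial (Fin m) ℝ →ₗ[ℝ] ℝ where
  toFun p := ∫ u : Metric.sphere (0 : EuclideanSpace ℝ (Fin m)) 1,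
    eval (u : EuclideanSpace ℝ (Fin m)).ofLp p ∂(sphereMeasure m)
  map_add' p q := by
    simp only [map_add]
    exact integral_add (integrable_sphere_eval p) (integrable_sphere_eval q)
  map_smul' c p := by
    simp [integral_const_mul]

lemma eval_smul_of_isHomogeneous {p : MvPolynomial (Fin m) ℝ} {d : ℕ} (hp : p.IsHomogeneous d)
    (r : ℝ) (v : Fin m → ℝ) : eval (r • v) p = r ^ d * eval v p := by
  rw [eval_eq, eval_eq, Finset.mul_sum]
  refine Finset.sum_congr rfl fun e he => ?_
  have h := hp (mem_support_iff.1 he)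
  simp only [Pi.smul_apply, smul_eq_mul, mul_pow, Finset.prod_mul_distrib,
    Finset.prod_pow_eq_pow_sum]
  rw [← h, Finsupp.weight_apply, Finsupp.sum]
  simp
  ring

/-- Polar coordinates: the Gaussian integral of a homogeneous polynomial is a multiple of its
integral over the sphere, with a nonzero factor that depends only on the degree. -/
lemma exists_gaussianIntegral_eq_mul_sphereIntegral [NeZero m] (d : ℕ) :
    ∃ c : ℝ, c ≠ 0 ∧ ∀ p : MvPolynomial (Fin m) ℝ, p.IsHomogeneous d →
      gaussianIntegral p = c * sphereIntegral m p := by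
  refine ⟨∫ r : Set.Ioi (0 : ℝ), (r : ℝ) ^ d * Real.exp (-(r : ℝ) ^ 2)
    ∂.volumeIoiPow (m - 1), ?_, fun p hp => ?_⟩
  · have h : ∫ r : Set.Ioi (0 : ℝ), (r : ℝ) ^ d * Real.exp (-(r : ℝ) ^ 2)
        ∂.volumeIoiPow (m - 1) =
        ∫ r in Set.Ioi (0 : ℝ), r ^ ((m - 1 + d : ℕ) : ℝ) * Real.exp (-r ^ (2 : ℝ)) := by
      simp only [Measure.volumeIoiPow, ENNReal.ofReal]
      rw [integral_withDensity_eq_integral_smul,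
        integral_subtype_comap measurableSet_Ioi fun a : ℝ =>
          Real.toNNReal (a ^ (m - 1)) • (a ^ d * Real.exp (-a ^ 2)),
        setIntegral_congr_fun measurableSet_Ioi fun x hx => ?_]
      · rw [NNReal.smul_def, Real.coe_toNNReal _ (pow_nonneg (le_of_lt hx) _), Real.rpow_natCast,
          pow_add, smul_eq_mul, Real.rpow_two, mul_assoc]
      · exact (measurable_subtype_coe.pow_const _).real_toNNReal
    rw [h, integral_rpow_mul_exp_neg_rpow (by norm_num)
      (by linarith [Nat.cast_nonneg (α := ℝ) (m - 1 + d)])]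
    have := Real.Gamma_pos_of_pos (s := (((m - 1 + d : ℕ) : ℝ) + 1) / 2) (by positivity)
    positivity
  · change ∫ u : EuclideanSpace ℝ (Fin m), eval u.ofLp p * Real.exp (-‖u‖ ^ 2) = _ * ∫ u, _ ∂_
    let E := EuclideanSpace ℝ (Fin m)
    calc
      _ = ∫ x : ({(0)}ᶜ : Set E), eval x.1.ofLp p * Real.exp (-‖x.1‖ ^ 2)
            ∂(Measure.comap Subtype.val volume) := by
        rw [integral_subtype_comap (measurableSet_singleton _).compl
          fun x : E => eval x.ofLp p * Real.exp (-‖x‖ ^ 2), restrict_compl_singleton]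
      _ = ∫ z : Metric.sphere (0 : E) 1 × Set.Ioi (0 : ℝ),
            eval (z.1 : E).ofLp p * ((z.2 : ℝ) ^ d * Real.exp (-(z.2 : ℝ) ^ 2))
            ∂(volume : Measure E).toSphere.prod (.volumeIoiPow (m - 1)) := by
        have := (volume : Measure E).measurePreserving_homeomorphUnitSphereProd.integral_comp
          (Homeomorph.measurableEmbedding _)
          (fun z : Metric.sphere (0 : E) 1 × Set.Ioi (0 : ℝ) =>
            eval (z.1 : E).ofLp p * ((z.2 : ℝ) ^ d * Real.exp (-(z.2 : ℝ) ^ 2)))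
        rw [finrank_euclideanSpace_fin] at this
        rw [← this]
        refine integral_congr_ae (Filter.Eventually.of_forall fun x => ?_)
        have hx : ‖(x : E)‖ ≠ 0 := norm_ne_zero_iff.2 x.2
        have hh := eval_smul_of_isHomogeneous hp ‖(x : E)‖⁻¹ (x : E).ofLp
        rw [← WithLp.ofLp_smul] at hh
        simp only [homeomorphUnitSphereProd_apply_fst_coe, homeomorphUnitSphereProd_apply_snd_coe]
        rw [hh, inv_pow]
        field_simp
      _ = _ := by
        rw [integral_prod_mul (fun z : Metric.sphere (0 : E) 1 => eval (z : E).ofLp p)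
          (fun r : Set.Ioi (0 : ℝ) => (r : ℝ) ^ d * Real.exp (-(r : ℝ) ^ 2)), mul_comm]
        rfl

/-- Homogeneous harmonic polynomials of different degrees are orthogonal on the sphere. -/
lemma sphereIntegral_mul_eq_zero [NeZero m] {p q : MvPolynomial (Fin m) ℝ} {a b : ℕ} (hab : a ≠ b)
    (hp : p.IsHomogeneous a) (hq : q.IsHomogeneous b)
    (hp0 : ∑ i, pderiv i (pderiv i p) = 0) (hq0 : ∑ i, pderiv i (pderiv i q) = 0) :
    sphereIntegral m (p * q) = 0 := by
  obtain ⟨c, hc, h⟩ := exists_gaussianIntegral_eq_mul_sphereIntegral (m := m) (a + b)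
  suffices gaussianIntegral (p * q) = 0 by
    rw [h _ (hp.mul hq)] at this
    exact (mul_eq_zero.1 this).resolve_left hc
  have h1 : ∑ i, pderiv i (p * pderiv i q - q * pderiv i p) = 0 := by
    have : ∀ i, pderiv i (p * pderiv i q - q * pderiv i p) =
        p * pderiv i (pderiv i q) - q * pderiv i (pderiv i p) := fun i => by
      rw [map_sub, pderiv_mul, pderiv_mul]; ring
    simp_rw [this, Finset.sum_sub_distrib, ← Finset.mul_sum, hp0, hq0, mul_zero, sub_zero]
  have h2 : ∑ i, X i * (p * pderiv i q - q * pderiv i p) = ((b : ℝ) - a) • (p * q) := by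
    have : ∀ i, X i * (p * pderiv i q - q * pderiv i p) =
        p * (X i * pderiv i q) - q * (X i * pderiv i p) := fun i => by ring
    simp_rw [this, Finset.sum_sub_distrib, ← Finset.mul_sum, hp.sum_X_mul_pderiv,
      hq.sum_X_mul_pderiv, sub_smul, Nat.cast_smul_eq_nsmul, mul_smul_comm, mul_comm q p]
  have h3 := congrArg gaussianIntegral h1
  simp_rw [map_sum, gaussianIntegral_pderiv, ← Finset.mul_sum, ← map_sum, h2, map_smul, map_zero,
    smul_eq_mul] at h3
  have hba : (b : ℝ) - a ≠ 0 := sub_ne_zero.2 (by exact_mod_cast hab.symm)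
  simpa [hba] using h3

lemma sum_pderiv_pderiv_pderiv {p : MvPolynomial (Fin m) ℝ}
    (hp0 : ∑ i, pderiv i (pderiv i p) = 0) (j : Fin m) :
    ∑ i, pderiv i (pderiv i (pderiv j p)) = 0 := by
  have : ∀ i, pderiv i (pderiv i (pderiv j p)) = pderiv j (pderiv i (pderiv i p)) := fun i => by
    rw [pderiv_pderiv_comm i j p, pderiv_pderiv_comm i j]
  simp_rw [this, ← map_sum, hp0, map_zero]

lemma sum_pderiv_pderiv_mul (p q : MvPolynomial (Fin m) ℝ) :
    ∑ i, pderiv i (pderiv i (p * q)) = (∑ i, pderiv i (pderiv i p)) * q +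
      2 * ∑ i, pderiv i p * pderiv i q + p * ∑ i, pderiv i (pderiv i q) := by
  simp only [Finset.sum_mul, Finset.mul_sum, ← Finset.sum_add_distrib]
  refine Finset.sum_congr rfl fun i _ => ?_
  simp only [pderiv_mul, map_add]
  ring

lemma pderiv_sum_X_sq (i : Fin m) :
    pderiv i (∑ j, X j ^ 2 : MvPolynomial (Fin m) ℝ) = 2 * X i := by
  simp [map_sum, Pi.single_apply]

lemma sphereIntegral_sum_X_sq_mul (p : MvPolynomial (Fin m) ℝ) :
    sphereIntegral m ((∑ j, X j ^ 2) * p) = sphereIntegral m p := by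
  refine integral_congr_ae (Filter.Eventually.of_forall fun u => ?_)
  have hu : ∑ j, (u : EuclideanSpace ℝ (Fin m)).ofLp j ^ 2 = 1 := by
    rw [← EuclideanSpace.real_norm_sq_eq, norm_eq_of_mem_sphere, one_pow]
  simp [map_sum, hu]

/-- Decomposing `X i * p` into harmonic components, only the component of degree `k - 1`
contributes when it is tested against a harmonic polynomial of degree `k - 1`. -/
lemma sphereIntegral_X_mul_mul [NeZero m] {p r : MvPolynomial (Fin m) ℝ} {k : ℕ} (hk : 1 ≤ k)
    (hp : p.IsHomogeneous k) (hr : r.IsHomogeneous (k - 1))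
    (hp0 : ∑ i, pderiv i (pderiv i p) = 0) (hr0 : ∑ i, pderiv i (pderiv i r) = 0) (i : Fin m) :
    ((m : ℝ) + 2 * k - 2) * sphereIntegral m (X i * p * r) =
      sphereIntegral m (pderiv i p * r) := by
  set N : ℝ := (m : ℝ) + 2 * k - 2
  set h : MvPolynomial (Fin m) ℝ := C N * (X i * p) - (∑ j, X j ^ 2) * pderiv i p with hh
  have hdp := hp.pderiv (i := i)
  have hh_hom : h.IsHomogeneous (k + 1) := by
    refine IsHomogeneous.sub ?_ ?_
    · have := (isHomogeneous_C (Fin m) N).mul ((isHomogeneous_X ℝ i).mul hp)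
      rwa [zero_add, add_comm] at this
    · have : (∑ j, X j ^ 2 : MvPolynomial (Fin m) ℝ).IsHomogeneous 2 :=
        IsHomogeneous.sum _ _ _ fun j _ => isHomogeneous_X_pow j 2
      have hmul := this.mul hdp
      rwa [show 2 + (k - 1) = k + 1 by omega] at hmul
  have hh0 : ∑ j, pderiv j (pderiv j h) = 0 := by
    have e1 : ∑ j, pderiv j (pderiv j (X i * p)) = 2 * pderiv i p := by
      rw [sum_pderiv_pderiv_mul, hp0]
      simp [Pi.single_apply, apply_ite]
    have e2 : ∑ j, pderiv j (pderiv j ((∑ j, X j ^ 2) * pderiv i p)) =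
        (2 * (m : MvPolynomial (Fin m) ℝ) + 4 * ((k - 1 : ℕ) : MvPolynomial (Fin m) ℝ)) *
          pderiv i p := by
      rw [sum_pderiv_pderiv_mul, sum_pderiv_pderiv_pderiv hp0]
      simp_rw [pderiv_sum_X_sq, mul_assoc, ← Finset.mul_sum, hdp.sum_X_mul_pderiv]
      simp [show ∀ i : Fin m, pderiv i (2 : MvPolynomial (Fin m) ℝ) = 0 from
        fun i => pderiv_C (a := (2 : ℝ))]
      ring
    have hN : (C N : MvPolynomial (Fin m) ℝ) =
        (m : MvPolynomial (Fin m) ℝ) + 2 * ((k - 1 : ℕ) : MvPolynomial (Fin m) ℝ) := by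
      have : N = m + 2 * ((k - 1 : ℕ) : ℝ) := by
        simp only [N]; push_cast [hk]; ring
      rw [this, C_add, C_mul, map_natCast, map_natCast, map_ofNat]
    simp_rw [hh, map_sub, pderiv_C_mul, Finset.sum_sub_distrib, ← Finset.mul_sum, e1, e2, hN]
    ring
  have := sphereIntegral_mul_eq_zero (by omega) hh_hom hr hh0 hr0
  rw [hh, sub_mul, map_sub, mul_assoc (∑ j, X j ^ 2), sphereIntegral_sum_X_sq_mul, mul_assoc,
    C_mul', map_smul, smul_eq_mul, sub_eq_zero] at this
  exact this

end HarmonicPolynomials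

section PolynomialValued

variable {m : ℕ}

/-- The polynomial `Σ_{α ∈ s} c_α u^α` in the variable `u`. -/
def coeffPoly (s : Finset (Fin m → ℕ)) (c : (Fin m → ℕ) → ℝ) : MvPolynomial (Fin m) ℝ :=
  ∑ α ∈ s, c α • monomial (Finsupp.equivFunOnFinite.symm α) 1

lemma eval_coeffPoly (s : Finset (Fin m → ℕ)) (c : (Fin m → ℕ) → ℝ) (v : Fin m → ℝ) :
    eval v (coeffPoly s c) = ∑ α ∈ s, c α * ∏ i, v i ^ α i := by
  simp [coeffPoly, eval_monomial, Finsupp.prod_fintype, map_sum, smul_eval]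

lemma coeff_coeffPoly {s : Finset (Fin m → ℕ)} (c : (Fin m → ℕ) → ℝ) {α : Fin m → ℕ}
    (hα : α ∈ s) : coeff (Finsupp.equivFunOnFinite.symm α) (coeffPoly s c) = c α := by
  classical
  simp [coeffPoly, coeff_sum, coeff_monomial, hα]

lemma isHomogeneous_coeffPoly {s : Finset (Fin m → ℕ)} {k : ℕ} (hs : ∀ α ∈ s, ∑ i, α i = k)
    (c : (Fin m → ℕ) → ℝ) : (coeffPoly s c).IsHomogeneous k := by
  refine IsHomogeneous.sum _ _ _ fun α hα => ?_
  rw [smul_monomial]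
  refine isHomogeneous_monomial _ ?_
  rw [← hs α hα, Finsupp.degree_eq_sum]
  rfl

lemma pdu_eval (P : EuclideanSpace ℝ (Fin m) → MvPolynomial (Fin m) ℝ) (i : Fin m) :
    pdu (fun x u => eval u.ofLp (P x)) i = fun x u => eval u.ofLp (pderiv i (P x)) := by
  ext x u
  exact fderiv_eval_mvPolynomial_single (P x) u i

lemma pdx_eval_coeffPoly {s : Finset (Fin m → ℕ)}
    {c : (Fin m → ℕ) → EuclideanSpace ℝ (Fin m) → ℝ} (hc : ∀ α ∈ s, Differentiable ℝ (c α))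
    (i : Fin m) :
    pdx (fun x u => eval u.ofLp (coeffPoly s fun α => c α x)) i =
      fun x u => eval u.ofLp (coeffPoly s fun α => pd (c α) i x) := by
  ext x u
  simp only [pdx, pd, eval_coeffPoly]
  rw [fderiv_fun_sum fun α hα => ((hc α hα) x).mul_const _]
  simp only [sum_apply]
  refine Finset.sum_congr rfl fun α hα => ?_
  rw [fderiv_mul_const ((hc α hα) x)]
  simp [mul_comm]

lemma contDiff_pd {n : ℕ} {c : EuclideanSpace ℝ (Fin m) → ℝ} (hc : ContDiff ℝ (n + 1) c)
    (i : Fin m) : ContDiff ℝ n (pd c i) :=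
  (hc.fderiv_right le_rfl).clm_apply contDiff_const

lemma eq_of_eval_ofLp {p q : MvPolynomial (Fin m) ℝ}
    (h : ∀ u : EuclideanSpace ℝ (Fin m), eval u.ofLp p = eval u.ofLp q) : p = q :=
  MvPolynomial.funext fun v => h (WithLp.toLp 2 v)

/-- Differentiation in `x` preserves harmonicity in `u`. -/
lemma laplacian_coeffPoly_pd {s : Finset (Fin m → ℕ)}
    {c : (Fin m → ℕ) → EuclideanSpace ℝ (Fin m) → ℝ} (hc : ∀ α ∈ s, Differentiable ℝ (c α))
    (h : ∀ x, ∑ j, pderiv j (pderiv j (coeffPoly s fun α => c α x)) = 0) (i : Fin m)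
    (x : EuclideanSpace ℝ (Fin m)) :
    ∑ j, pderiv j (pderiv j (coeffPoly s fun α => pd (c α) i x)) = 0 := by
  have expand : ∀ (b : (Fin m → ℕ) → ℝ) (u : EuclideanSpace ℝ (Fin m)),
      eval u.ofLp (∑ j, pderiv j (pderiv j (coeffPoly s b))) = ∑ α ∈ s, b α *
        eval u.ofLp (∑ j, pderiv j (pderiv j
          (monomial (Finsupp.equivFunOnFinite.symm α) (1 : ℝ)))) := fun b u => by
    simp only [coeffPoly, map_sum, Derivation.map_smul, smul_eval, Finset.mul_sum]
    exact Finset.sum_comm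
  refine eq_of_eval_ofLp fun u => ?_
  have hz : (fun x => ∑ α ∈ s, c α x * eval u.ofLp (∑ j, pderiv j (pderiv j
      (monomial (Finsupp.equivFunOnFinite.symm α) (1 : ℝ))))) = fun _ => (0 : ℝ) := by
    ext x
    rw [← expand (fun α => c α x), h x, map_zero]
  rw [expand, map_zero]
  have hd := congrArg (fun F => fderiv ℝ F x (EuclideanSpace.single i 1)) hz
  rw [fderiv_fun_sum fun α hα => ((hc α hα) x).mul_const _] at hd
  simp only [sum_apply, fderiv_fun_const, Pi.zero_apply,
    zero_apply] at hd
  rw [← hd]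
  refine Finset.sum_congr rfl fun α hα => ?_
  rw [fderiv_mul_const ((hc α hα) x)]
  simp [pd, mul_comm]

/-- The coupling of the coefficients `∂_i ∂_j c_α` and `d_β` after integration over the sphere. -/
def sphereCoupling (m k : ℕ) (i j : Fin m) (α β : Fin m → ℕ) : ℝ :=
  (if i = j then sphereIntegral m (monomial (Finsupp.equivFunOnFinite.symm α) 1 *
    monomial (Finsupp.equivFunOnFinite.symm β) 1) else 0) -
  4 / ((m : ℝ) + 2 * k - 2) ^ 2 *
    sphereIntegral m (pderiv j (monomial (Finsupp.equivFunOnFinite.symm α) 1) *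
      pderiv i (monomial (Finsupp.equivFunOnFinite.symm β) 1))

lemma sphereCoupling_swap (k : ℕ) (i j : Fin m) (α β : Fin m → ℕ) :
    sphereCoupling m k i j α β = sphereCoupling m k j i β α := by
  simp only [sphereCoupling, eq_comm (a := i),
    mul_comm (monomial (Finsupp.equivFunOnFinite.symm α) _),
    mul_comm (pderiv j (monomial (Finsupp.equivFunOnFinite.symm α) _))]

lemma sphereIntegral_coeffPoly_mul (s t : Finset (Fin m → ℕ)) (a b : (Fin m → ℕ) → ℝ)
    (A B : MvPolynomial (Fin m) ℝ →ₗ[ℝ] MvPolynomial (Fin m) ℝ) :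
    sphereIntegral m (A (coeffPoly s a) * B (coeffPoly t b)) = ∑ α ∈ s, ∑ β ∈ t, a α * b β *
      sphereIntegral m (A (monomial (Finsupp.equivFunOnFinite.symm α) 1) *
        B (monomial (Finsupp.equivFunOnFinite.symm β) 1)) := by
  simp only [coeffPoly, map_sum, map_smul, Finset.sum_mul, Finset.mul_sum, smul_mul_smul_comm,
    smul_eq_mul]
  exact Finset.sum_comm

lemma bosonicLaplacian_eval (k : ℕ) {s : Finset (Fin m → ℕ)}
    {c : (Fin m → ℕ) → EuclideanSpace ℝ (Fin m) → ℝ} (hc : ∀ α ∈ s, ContDiff ℝ 2 (c α))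
    (x u : EuclideanSpace ℝ (Fin m)) (hu : ‖u‖ = 1) :
    bosonicLaplacian m k (fun x u => eval u.ofLp (coeffPoly s fun α => c α x)) x u =
      eval u.ofLp (∑ i, coeffPoly s (fun α => pd (pd (c α) i) i x)
        - (4 / ((m : ℝ) + 2 * k - 2)) •
          ∑ i, ∑ j, X i * pderiv j (coeffPoly s fun α => pd (pd (c α) j) i x)
        + (4 / (((m : ℝ) + 2 * k - 2) * ((m : ℝ) + 2 * k - 4))) •
          ∑ i, ∑ j, pderiv i (pderiv j (coeffPoly s fun α => pd (pd (c α) j) i x))) := by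
  have h1 : ∀ i j, pdx (pdx (fun x u => eval u.ofLp (coeffPoly s fun α => c α x)) j) i =
      fun x u => eval u.ofLp (coeffPoly s fun α => pd (pd (c α) j) i x) := fun i j => by
    rw [pdx_eval_coeffPoly (fun α hα => (hc α hα).differentiable (by norm_num)),
      pdx_eval_coeffPoly fun α hα =>
        (contDiff_pd (n := 1) (hc α hα) j).differentiable (by norm_num)]
  simp only [bosonicLaplacian, h1, pdu_eval, hu]
  simp [map_sum, smul_eval]

/-- On the sphere the last term of the bosonic Laplacian pairs to zero with `H_k` and the middle
term pairs to a multiple of `⟨∂_{u_j} ∂_{x_i} ∂_{x_j} f, ∂_{u_i} g⟩`. -/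
lemma integral_sphere_bosonicLaplacian_mul {k : ℕ} (hm : 3 ≤ m) (hk : 1 ≤ k)
    {s t : Finset (Fin m → ℕ)} {c d : (Fin m → ℕ) → EuclideanSpace ℝ (Fin m) → ℝ}
    (hs : ∀ α ∈ s, ∑ i, α i = k) (ht : ∀ β ∈ t, ∑ i, β i = k)
    (hc : ∀ α ∈ s, ContDiff ℝ 2 (c α))
    (hc0 : ∀ x, ∑ j, pderiv j (pderiv j (coeffPoly s fun α => c α x)) = 0)
    (hd0 : ∀ x, ∑ j, pderiv j (pderiv j (coeffPoly t fun β => d β x)) = 0)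
    (x : EuclideanSpace ℝ (Fin m)) :
    ∫ u : Metric.sphere (0 : EuclideanSpace ℝ (Fin m)) 1,
      bosonicLaplacian m k (fun x u => eval u.ofLp (coeffPoly s fun α => c α x)) x u *
        eval (u : EuclideanSpace ℝ (Fin m)).ofLp (coeffPoly t fun β => d β x) ∂(sphereMeasure m) =
    ∑ i, ∑ j, ∑ α ∈ s, ∑ β ∈ t,
      pd (pd (c α) j) i x * d β x * sphereCoupling m k i j α β := by
  have : NeZero m := ⟨by omega⟩
  have hc1 : ∀ j, ∀ α ∈ s, ContDiff ℝ 1 (pd (c α) j) := fun j α hα =>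
    contDiff_pd (n := 1) (hc α hα) j
  set P : Fin m → Fin m → MvPolynomial (Fin m) ℝ := fun i j =>
    coeffPoly s fun α => pd (pd (c α) j) i x with hP
  set Q := coeffPoly t fun β => d β x with hQ
  have hPhom : ∀ i j, (P i j).IsHomogeneous k := fun i j => isHomogeneous_coeffPoly hs _
  have hQhom : Q.IsHomogeneous k := isHomogeneous_coeffPoly ht _
  have hP0 : ∀ i j, ∑ l, pderiv l (pderiv l (P i j)) = 0 := fun i j =>
    laplacian_coeffPoly_pd (fun α hα => (hc1 j α hα).differentiable (by norm_num))
      (fun y => laplacian_coeffPoly_pd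
        (fun α hα => (hc α hα).differentiable (by norm_num)) hc0 j y) i x
  have hN : (m : ℝ) + 2 * k - 2 ≠ 0 := by
    have h1 : (3 : ℝ) ≤ m := by exact_mod_cast hm
    have h2 : (1 : ℝ) ≤ k := by exact_mod_cast hk
    linarith
  have mid : ∀ i j, sphereIntegral m (X i * pderiv j (P i j) * Q) =
      ((m : ℝ) + 2 * k - 2)⁻¹ * sphereIntegral m (pderiv j (P i j) * pderiv i Q) := fun i j => by
    rw [eq_inv_mul_iff_mul_eq₀ hN, mul_right_comm, mul_comm (pderiv j (P i j)) (pderiv i Q)]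
    exact sphereIntegral_X_mul_mul hk hQhom (hPhom i j).pderiv (hd0 x)
      (sum_pderiv_pderiv_pderiv (hP0 i j) j) i
  have last : ∀ i j, sphereIntegral m (pderiv i (pderiv j (P i j)) * Q) = 0 := fun i j =>
    sphereIntegral_mul_eq_zero (by omega) (hPhom i j).pderiv.pderiv hQhom
      (sum_pderiv_pderiv_pderiv (sum_pderiv_pderiv_pderiv (hP0 i j) j) i) (hd0 x)
  calc
    _ = sphereIntegral m ((∑ i, P i i - (4 / ((m : ℝ) + 2 * k - 2)) •
          ∑ i, ∑ j, X i * pderiv j (P i j)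
        + (4 / (((m : ℝ) + 2 * k - 2) * ((m : ℝ) + 2 * k - 4))) •
          ∑ i, ∑ j, pderiv i (pderiv j (P i j))) * Q) := by
      refine integral_congr_ae (Filter.Eventually.of_forall fun u => ?_)
      simp only [map_mul]
      rw [bosonicLaplacian_eval k hc x u (norm_eq_of_mem_sphere u)]
    _ = ∑ i, sphereIntegral m (P i i * Q) - 4 / ((m : ℝ) + 2 * k - 2) ^ 2 *
          ∑ i, ∑ j, sphereIntegral m (pderiv j (P i j) * pderiv i Q) := by
      simp only [add_mul, sub_mul, smul_mul_assoc, Finset.sum_mul, map_add, map_sub, map_smul,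
        map_sum, mid, last, smul_eq_mul]
      simp only [← Finset.mul_sum, Finset.sum_const_zero, mul_zero, add_zero]
      field_simp
    _ = _ := by
      have e1 := fun i => sphereIntegral_coeffPoly_mul s t (fun α => pd (pd (c α) i) i x)
        (fun β => d β x) LinearMap.id LinearMap.id
      have e2 := fun i j => sphereIntegral_coeffPoly_mul s t (fun α => pd (pd (c α) j) i x)
        (fun β => d β x) (pderiv j).toLinearMap (pderiv i).toLinearMap
      simp only [LinearMap.id_coe, id_eq, Derivation.coeFn_coe] at e1 e2
      simp only [hP, hQ, e1, e2, sphereCoupling, mul_sub, Finset.sum_sub_distrib, Finset.mul_sum]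
      congr 1
      · refine Finset.sum_congr rfl fun i _ => ?_
        rw [Finset.sum_eq_single i (fun j _ hj => by simp [hj.symm]) (by simp)]
        simp
      · refine Finset.sum_congr rfl fun i _ => Finset.sum_congr rfl fun j _ =>
          Finset.sum_congr rfl fun α _ => Finset.sum_congr rfl fun β _ => by ring

lemma integral_pd_mul {c d : EuclideanSpace ℝ (Fin m) → ℝ} (hc : ContDiff ℝ 1 c)
    (hd : ContDiff ℝ 1 d) (hcd : HasCompactSupport c ∨ HasCompactSupport d) (i : Fin m) :
    ∫ x, pd c i x * d x = -∫ x, c x * pd d i x := by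
  have hpc : Continuous (pd c i) := (contDiff_pd (n := 0) (by simpa using hc) i).continuous
  have hpd : Continuous (pd d i) := (contDiff_pd (n := 0) (by simpa using hd) i).continuous
  have key := integral_mul_fderiv_eq_neg_fderiv_mul_of_integrable
    (μ := (volume : Measure (EuclideanSpace ℝ (Fin m)))) (f := c) (g := d)
    (v := EuclideanSpace.single i 1) ?_ ?_ ?_
    (fun x _ => hc.differentiable (by norm_num) x) (fun x _ => hd.differentiable (by norm_num) x)
  · rw [← neg_eq_iff_eq_neg] at key
    exact key.symm
  · refine (hpc.mul hd.continuous).integrable_of_hasCompactSupport ?_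
    rcases hcd with h | h
    · exact (h.fderiv_apply ℝ _).mul_right
    · exact h.mul_left
  · refine (hc.continuous.mul hpd).integrable_of_hasCompactSupport ?_
    rcases hcd with h | h
    · exact h.mul_right
    · exact (h.fderiv_apply ℝ _).mul_left
  · refine (hc.continuous.mul hd.continuous).integrable_of_hasCompactSupport ?_
    rcases hcd with h | h
    · exact h.mul_right
    · exact h.mul_left

lemma integral_pd_pd_mul {c d : EuclideanSpace ℝ (Fin m) → ℝ} (hc : ContDiff ℝ 2 c)
    (hd : ContDiff ℝ 2 d) (hcs : HasCompactSupport c) (i j : Fin m) :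
    ∫ x, pd (pd c j) i x * d x = ∫ x, pd (pd d i) j x * c x := by
  have hcj : HasCompactSupport (pd c j) := hcs.fderiv_apply ℝ _
  rw [integral_pd_mul (contDiff_pd (n := 1) hc j) (hd.of_le (by norm_num)) (.inl hcj),
    integral_pd_mul (hc.of_le (by norm_num)) (contDiff_pd (n := 1) hd i) (.inl hcs), neg_neg]
  simp_rw [mul_comm]

/-- Each `H_k`-valued function is given by harmonic polynomials with the same coefficients. -/
lemma ValuesInHk.exists_coeffPoly {k : ℕ} {P : (EuclideanSpace ℝ (Fin m) → ℝ) → Prop}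
    {f : EuclideanSpace ℝ (Fin m) → EuclideanSpace ℝ (Fin m) → ℝ} (hf : ValuesInHk m k P f) :
    ∃ (s : Finset (Fin m → ℕ)) (c : (Fin m → ℕ) → EuclideanSpace ℝ (Fin m) → ℝ),
      (∀ α ∈ s, ∑ i, α i = k) ∧ (∀ α ∈ s, P (c α)) ∧
      (f = fun x u => eval u.ofLp (coeffPoly s fun α => c α x)) ∧
      ∀ x, ∑ j, pderiv j (pderiv j (coeffPoly s fun α => c α x)) = 0 := by
  obtain ⟨⟨s, c, hs, hc, hfc⟩, hf0⟩ := hf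
  have hfeq : f = fun x u => eval u.ofLp (coeffPoly s fun α => c α x) := by
    ext x u
    rw [hfc, eval_coeffPoly]
  refine ⟨s, c, hs, hc, hfeq, fun x => eq_of_eval_ofLp fun u => ?_⟩
  have := hf0 x u
  simp only [hfeq, pdu_eval] at this
  simpa [map_sum] using this

lemma integral_sum_mul_sphereCoupling (k : ℕ) {s t : Finset (Fin m → ℕ)}
    {a : Fin m → Fin m → (Fin m → ℕ) → (Fin m → ℕ) → EuclideanSpace ℝ (Fin m) → ℝ}
    (ha : ∀ i j, ∀ α ∈ s, ∀ β ∈ t, Integrable (a i j α β)) :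
    ∫ x, ∑ i, ∑ j, ∑ α ∈ s, ∑ β ∈ t, a i j α β x * sphereCoupling m k i j α β =
      ∑ i, ∑ j, ∑ α ∈ s, ∑ β ∈ t, (∫ x, a i j α β x) * sphereCoupling m k i j α β := by
  have h1 : ∀ i j, ∀ α ∈ s, ∀ β ∈ t,
      Integrable fun x => a i j α β x * sphereCoupling m k i j α β :=
    fun i j α hα β hβ => (ha i j α hα β hβ).mul_const _
  have h2 := fun i j α hα => integrable_finsetSum t (h1 i j α hα)
  have h3 := fun i j => integrable_finsetSum s (h2 i j)
  have h4 := fun i => integrable_finsetSum Finset.univ fun j _ => h3 i j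
  rw [integral_finsetSum _ fun i _ => h4 i]
  refine Finset.sum_congr rfl fun i _ => ?_
  rw [integral_finsetSum _ fun j _ => h3 i j]
  refine Finset.sum_congr rfl fun j _ => ?_
  rw [integral_finsetSum _ (h2 i j)]
  refine Finset.sum_congr rfl fun α hα => ?_
  rw [integral_finsetSum _ (h1 i j α hα)]
  exact Finset.sum_congr rfl fun β _ => integral_mul_const _ _

end PolynomialValued

/-- Self-adjointness of the bosonic Laplacian (scalar-valued case):  for `f, g` taking
values in `H_k` with `C²` coefficients, `f` compactly supported in `x`,
`∫_{ℝ^m}∫_{S^{m-1}} (D_k f) g dS(u) dx = ∫_{ℝ^m}∫_{S^{m-1}} f (D_k g) dS(u) dx`. -/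
theorem bosonic_laplacian_self_adjoint (m k : ℕ) (hm : 3 ≤ m) (hk : 1 ≤ k)
    (f g : EuclideanSpace ℝ (Fin m) → EuclideanSpace ℝ (Fin m) → ℝ)
    (hf : ValuesInHk m k (fun c => ContDiff ℝ 2 c) f)
    (hg : ValuesInHk m k (fun c => ContDiff ℝ 2 c) g)
    (hsupp : ∃ K : Set (EuclideanSpace ℝ (Fin m)), IsCompact K ∧
      ∀ x ∉ K, ∀ u, f x u = 0) :
    (∫ x : EuclideanSpace ℝ (Fin m),
      ∫ u : Metric.sphere (0 : EuclideanSpace ℝ (Fin m)) 1,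
        bosonicLaplacian m k f x (u : EuclideanSpace ℝ (Fin m)) *
          g x (u : EuclideanSpace ℝ (Fin m)) ∂(sphereMeasure m))
    = ∫ x : EuclideanSpace ℝ (Fin m),
        ∫ u : Metric.sphere (0 : EuclideanSpace ℝ (Fin m)) 1,
          f x (u : EuclideanSpace ℝ (Fin m)) *
            bosonicLaplacian m k g x (u : EuclideanSpace ℝ (Fin m)) ∂(sphereMeasure m) := by
  obtain ⟨s, c, hs, hc, rfl, hc0⟩ := hf.exists_coeffPoly
  obtain ⟨t, d, ht, hd, rfl, hd0⟩ := hg.exists_coeffPoly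
  obtain ⟨K, hK, hsupp⟩ := hsupp
  have hcs : ∀ α ∈ s, HasCompactSupport (c α) := fun α hα =>
    HasCompactSupport.intro hK fun x hx => by
      have : coeffPoly s (fun α => c α x) = 0 :=
        eq_of_eval_ofLp fun u => (hsupp x hx u).trans (map_zero _).symm
      rw [← coeff_coeffPoly (fun α => c α x) hα, this, coeff_zero]
  have hpd : ∀ {e : EuclideanSpace ℝ (Fin m) → ℝ}, ContDiff ℝ 2 e → ∀ i j,
      Continuous (pd (pd e j) i) := fun he i j =>
    (contDiff_pd (n := 0) (by simpa using contDiff_pd (n := 1) he j) i).continuous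
  have hint : ∀ i j, ∀ α ∈ s, ∀ β ∈ t, Integrable fun x => pd (pd (c α) j) i x * d β x :=
    fun i j α hα β hβ => ((hpd (hc α hα) i j).mul
      (hd β hβ).continuous).integrable_of_hasCompactSupport
        (((hcs α hα).fderiv_apply ℝ _).fderiv_apply ℝ _).mul_right
  have hint' : ∀ i j, ∀ α ∈ s, ∀ β ∈ t, Integrable fun x => pd (pd (d β) j) i x * c α x :=
    fun i j α hα β hβ => ((hpd (hd β hβ) i j).mul
      (hc α hα).continuous).integrable_of_hasCompactSupport (hcs α hα).mul_left
  simp_rw [mul_comm (eval _ (coeffPoly s _)),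
    integral_sphere_bosonicLaplacian_mul hm hk hs ht hc hc0 hd0,
    integral_sphere_bosonicLaplacian_mul hm hk ht hs hd hd0 hc0]
  rw [integral_sum_mul_sphereCoupling k hint,
    integral_sum_mul_sphereCoupling k fun i j β hβ α hα => hint' i j α hα β hβ, Finset.sum_comm]
  refine Finset.sum_congr rfl fun j _ => Finset.sum_congr rfl fun i _ => ?_
  rw [Finset.sum_comm]
  refine Finset.sum_congr rfl fun β hβ => Finset.sum_congr rfl fun α hα => ?_
  rw [integral_pd_pd_mul (hc α hα) (hd β hβ) (hcs α hα), sphereCoupling_swap]
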